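/- arXiv:2503.04423 — 6 statements merged into one kernel-verified Lean document; each statement's English description precedes it below -/
import Mathlib

section
/- Every stabilizer group is abelian: if S is a subgroup of the N-qubit Pauli group 𝒫_N with -1 ∉ S (where -1 denotes minus the identity matrix), then g * h = h * g for all g, h ∈ S. -/
open Matrix

/-- The four Pauli matrices: `σ⁰ = 1`, `σ¹ = X`, `σ² = Y`, `σ³ = Z`. -/
noncomputable def pauli : Fin 4 → Matrix (Fin 2) (Fin 2) ℂ :=
  ![1, !![0, 1; 1, 0], !![0, -Complex.I; Complex.I, 0], !![1, 0; 0, -1]]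

/-- The `N`-qubit Pauli string `Σ^μ = σ^{μ 0} ⊗ ⋯ ⊗ σ^{μ (N-1)}`. -/
noncomputable def pauliString {N : ℕ} (μ : Fin N → Fin 4) :
    Matrix (Fin N → Fin 2) (Fin N → Fin 2) ℂ :=
  Matrix.of fun x y => ∏ i, pauli (μ i) (x i) (y i)

/-- The `N`-qubit Pauli group `𝒫_N`: matrices `c • Σ^μ` with `c ∈ {1, -1, i, -i}`. -/
def pauliGroup (N : ℕ) : Set (Matrix (Fin N → Fin 2) (Fin N → Fin 2) ℂ) :=
  { M | ∃ c ∈ ({1, -1, Complex.I, -Complex.I} : Set ℂ),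
      ∃ μ : Fin N → Fin 4, M = c • pauliString μ }

theorem pauli_mul_self (a : Fin 4) : pauli a * pauli a = 1 := by
  fin_cases a <;> ext i j <;> fin_cases i <;> fin_cases j <;>
    simp [pauli, Matrix.mul_apply, Fin.sum_univ_two]

theorem pauli_mul_comm_or_anticomm (a b : Fin 4) :
    ∃ ε : ℂ, (ε = 1 ∨ ε = -1) ∧ pauli a * pauli b = ε • (pauli b * pauli a) := by
  have h : pauli a * pauli b = pauli b * pauli a ∨
      pauli a * pauli b = -(pauli b * pauli a) := by
    fin_cases a <;> fin_cases b <;> simp [pauli]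
  rcases h with h | h
  · exact ⟨1, .inl rfl, by simpa using h⟩
  · exact ⟨-1, .inr rfl, by simpa using h⟩

theorem pauliString_mul_apply {N : ℕ} (μ ν : Fin N → Fin 4) (x y : Fin N → Fin 2) :
    (pauliString μ * pauliString ν) x y = ∏ i, (pauli (μ i) * pauli (ν i)) (x i) (y i) := by
  simp only [Matrix.mul_apply, pauliString, Matrix.of_apply, ← Finset.prod_mul_distrib]
  rw [Finset.prod_univ_sum, Fintype.piFinset_univ]

theorem pauliString_mul_self {N : ℕ} (μ : Fin N → Fin 4) :
    pauliString μ * pauliString μ = 1 := by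
  ext x y
  simp only [pauliString_mul_apply, pauli_mul_self, Matrix.one_apply, funext_iff,
    Fintype.prod_boole]
  congr

theorem pauliString_mul_comm_or_anticomm {N : ℕ} (μ ν : Fin N → Fin 4) :
    pauliString μ * pauliString ν = pauliString ν * pauliString μ ∨
      pauliString μ * pauliString ν = -(pauliString ν * pauliString μ) := by
  choose ε hε hcomm using fun i => pauli_mul_comm_or_anticomm (μ i) (ν i)
  have hprod : ∏ i, ε i = 1 ∨ ∏ i, ε i = -1 :=
    Finset.prod_induction ε (fun z => z = 1 ∨ z = -1)
      (by rintro _ _ (rfl | rfl) (rfl | rfl) <;> simp) (.inl rfl) fun i _ => hε i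
  have hstring : pauliString μ * pauliString ν =
      (∏ i, ε i) • (pauliString ν * pauliString μ) := by
    ext x y
    simp only [Matrix.smul_apply, pauliString_mul_apply, hcomm, smul_eq_mul,
      Finset.prod_mul_distrib]
  rcases hprod with h | h <;> rw [h] at hstring
  · exact .inl (by simpa using hstring)
  · exact .inr (by simpa using hstring)

theorem mul_self_eq_one_or_neg_one_of_mem_pauliGroup {N : ℕ}
    {g : Matrix (Fin N → Fin 2) (Fin N → Fin 2) ℂ} (hg : g ∈ pauliGroup N) :
    g * g = 1 ∨ g * g = -1 := by
  obtain ⟨c, hc, μ, rfl⟩ := hg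
  simp only [Set.mem_insert_iff, Set.mem_singleton_iff] at hc
  rcases hc with rfl | rfl | rfl | rfl <;> simp [pauliString_mul_self, smul_smul]

theorem mul_comm_or_anticomm_of_mem_pauliGroup {N : ℕ}
    {g h : Matrix (Fin N → Fin 2) (Fin N → Fin 2) ℂ}
    (hg : g ∈ pauliGroup N) (hh : h ∈ pauliGroup N) :
    g * h = h * g ∨ g * h = -(h * g) := by
  obtain ⟨c, -, μ, rfl⟩ := hg
  obtain ⟨d, -, ν, rfl⟩ := hh
  simp only [smul_mul_smul_comm, mul_comm d c, ← smul_neg]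
  exact (pauliString_mul_comm_or_anticomm μ ν).imp (congrArg _) (congrArg _)

/-- Every stabilizer group is abelian: a subgroup `S` of the Pauli group `𝒫_N`
not containing `-1` is commutative. -/
theorem stabilizer_group_abelian {N : ℕ} (hN : 1 ≤ N)
    (S : Set (Matrix (Fin N → Fin 2) (Fin N → Fin 2) ℂ))
    (hSsub : S ⊆ pauliGroup N)
    (hone : (1 : Matrix (Fin N → Fin 2) (Fin N → Fin 2) ℂ) ∈ S)
    (hmul : ∀ g ∈ S, ∀ h ∈ S, g * h ∈ S)
    (hinv : ∀ g ∈ S, ∃ g' ∈ S, g * g' = 1)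
    (hneg : -(1 : Matrix (Fin N → Fin 2) (Fin N → Fin 2) ℂ) ∉ S) :
    ∀ g ∈ S, ∀ h ∈ S, g * h = h * g := by
  intro g hg h hh
  have mul_self_eq_one {k} (hk : k ∈ S) : k * k = 1 :=
    (mul_self_eq_one_or_neg_one_of_mem_pauliGroup (hSsub hk)).resolve_right
      fun hk' => hneg (hk' ▸ hmul k hk k hk)
  refine (mul_comm_or_anticomm_of_mem_pauliGroup (hSsub hg) (hSsub hh)).resolve_right
    fun hanti => hneg ?_
  have hsq : (g * h) * (g * h) = -1 := by
    calc (g * h) * (g * h) = -((h * g) * (g * h)) := by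
          nth_rewrite 1 [hanti]
          rw [neg_mul]
      _ = -(h * (g * g) * h) := by simp only [mul_assoc]
      _ = -1 := by rw [mul_self_eq_one hg, mul_one, mul_self_eq_one hh]
  exact hsq ▸ hmul _ (hmul g hg h hh) _ (hmul g hg h hh)
end

section
/- Let S be a subgroup of the N-qubit Pauli group 𝒫_N with -1 ∉ S and cardinality |S| = 2^k for some k ≤ N, and let P_S := 2^{-k} • ∑_{g ∈ S} g. Then trace(P_S) = 2^{N-k}; consequently P_S is an orthogonal projection of rank 2^{N-k}, i.e. the stabilizer subspace V_S = {v : g.mulVec v = v for all g ∈ S} has dimension 2^{N-k}. -/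
open Matrix

/-- The stabilizer subspace `V_S = {v | g.mulVec v = v for all g ∈ S}`, as a
`ℂ`-submodule of `ℂ^{2^N}`. -/
noncomputable def stabSubspace {N : ℕ} (S : Finset (Matrix (Fin N → Fin 2) (Fin N → Fin 2) ℂ)) :
    Submodule ℂ ((Fin N → Fin 2) → ℂ) where
  carrier := { v | ∀ g ∈ S, g.mulVec v = v }
  add_mem' := by
    intro a b ha hb g hg
    rw [Matrix.mulVec_add, ha g hg, hb g hg]
  zero_mem' := by
    intro g hg
    rw [Matrix.mulVec_zero]
  smul_mem' := by
    intro c v hv g hg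
    rw [Matrix.mulVec_smul, hv g hg]

theorem trace_pauli {a : Fin 4} (ha : a ≠ 0) : (pauli a).trace = 0 := by
  fin_cases a <;> simp_all [pauli, Matrix.trace, Fin.sum_univ_two]

theorem trace_pauliString {N : ℕ} (μ : Fin N → Fin 4) :
    (pauliString μ).trace = ∏ i, (pauli (μ i)).trace := by
  simp only [Matrix.trace, Matrix.diag_apply, pauliString, Matrix.of_apply, Fintype.prod_sum]

theorem pauliString_zero {N : ℕ} : pauliString (0 : Fin N → Fin 4) = 1 := by
  ext x y
  by_cases h : x = y
  · subst h
    simp [pauliString, pauli]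
  · obtain ⟨i, hi⟩ := Function.ne_iff.mp h
    rw [Matrix.one_apply_ne h]
    exact Finset.prod_eq_zero (Finset.mem_univ i) (Matrix.one_apply_ne hi)

/-- An element of the Pauli group is traceless unless it is `1` or one of `g`, `g * g` is `-1`. -/
theorem trace_eq_zero_of_mem_pauliGroup {N : ℕ}
    {g : Matrix (Fin N → Fin 2) (Fin N → Fin 2) ℂ} (hg : g ∈ pauliGroup N)
    (hone : g ≠ 1) (hneg : g ≠ -1) (hsq : g * g ≠ -1) : g.trace = 0 := by
  obtain ⟨c, hc, μ, rfl⟩ := hg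
  by_cases hμ : μ = 0
  · subst hμ
    rw [pauliString_zero] at hone hneg hsq
    rcases hc with rfl | rfl | rfl | rfl <;> simp [smul_smul] at hone hneg hsq
  · obtain ⟨i, hi⟩ := Function.ne_iff.mp hμ
    rw [Matrix.trace_smul, trace_pauliString,
      Finset.prod_eq_zero (Finset.mem_univ i) (trace_pauli hi), smul_zero]

/-- Left multiplication by an element of a finite group of matrices fixes the sum of the group. -/
theorem mul_sum_eq_sum_of_mem {n R : Type*} [Fintype n] [DecidableEq n] [CommRing R]
    {S : Finset (Matrix n n R)} (hmul : ∀ g ∈ S, ∀ h ∈ S, g * h ∈ S)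
    (hinv : ∀ g ∈ S, ∃ g' ∈ S, g * g' = 1) {g : Matrix n n R} (hg : g ∈ S) :
    g * ∑ h ∈ S, h = ∑ h ∈ S, h := by
  obtain ⟨g', hg', hgg'⟩ := hinv g hg
  have hg'g : g' * g = 1 := mul_eq_one_comm.mp hgg'
  rw [Finset.mul_sum]
  refine Finset.sum_bij' (fun h _ => g * h) (fun h _ => g' * h) (hmul g hg) (hmul g' hg') ?_ ?_
    fun _ _ => rfl
  · intro h _
    rw [← mul_assoc, hg'g, one_mul]
  · intro h _
    rw [← mul_assoc, hgg', one_mul]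

/-- The average of a finite group of matrices is a projection onto the fixed subspace. -/
theorem isProj_stabSubspace {N : ℕ} {S : Finset (Matrix (Fin N → Fin 2) (Fin N → Fin 2) ℂ)}
    (hS : S.Nonempty) (hmul : ∀ g ∈ S, ∀ h ∈ S, g * h ∈ S)
    (hinv : ∀ g ∈ S, ∃ g' ∈ S, g * g' = 1) :
    LinearMap.IsProj (stabSubspace S) (Matrix.toLin' ((S.card : ℂ)⁻¹ • ∑ g ∈ S, g)) where
  map_mem v g hg := by
    rw [Matrix.toLin'_apply, Matrix.mulVec_mulVec, Matrix.mul_smul,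
      mul_sum_eq_sum_of_mem hmul hinv hg]
  map_id v hv := by
    have hcard : (S.card : ℂ) ≠ 0 := Nat.cast_ne_zero.mpr hS.card_ne_zero
    rw [Matrix.toLin'_apply, Matrix.smul_mulVec, Matrix.sum_mulVec, Finset.sum_congr rfl hv,
      Finset.sum_const, ← Nat.cast_smul_eq_nsmul ℂ, smul_smul, inv_mul_cancel₀ hcard, one_smul]

/-- Dimension of a stabilizer subspace: if `S ≤ 𝒫_N` is a stabilizer group with
`|S| = 2^k`, `k ≤ N`, then `P_S = 2^{-k} • ∑_{g ∈ S} g` has trace `2^{N-k}`, and the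
stabilizer subspace `V_S` has dimension `2^{N-k}`. -/
theorem stabilizer_subspace_dim {N k : ℕ} (hN : 1 ≤ N) (hk : k ≤ N)
    (S : Finset (Matrix (Fin N → Fin 2) (Fin N → Fin 2) ℂ))
    (hSsub : (S : Set (Matrix (Fin N → Fin 2) (Fin N → Fin 2) ℂ)) ⊆ pauliGroup N)
    (hone : (1 : Matrix (Fin N → Fin 2) (Fin N → Fin 2) ℂ) ∈ S)
    (hmul : ∀ g ∈ S, ∀ h ∈ S, g * h ∈ S)
    (hinv : ∀ g ∈ S, ∃ g' ∈ S, g * g' = 1)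
    (hneg : -(1 : Matrix (Fin N → Fin 2) (Fin N → Fin 2) ℂ) ∉ S)
    (hcard : S.card = 2 ^ k)
    (P : Matrix (Fin N → Fin 2) (Fin N → Fin 2) ℂ)
    (hP : P = ((2 : ℂ) ^ k)⁻¹ • ∑ g ∈ S, g) :
    P.trace = (2 : ℂ) ^ (N - k) ∧
      Module.finrank ℂ (stabSubspace S) = 2 ^ (N - k) := by
  have htrace_sum : (∑ g ∈ S, g).trace = (2 : ℂ) ^ N := by
    rw [Matrix.trace_sum, Finset.sum_eq_single_of_mem 1 hone]
    · simp
    · intro g hg hg1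
      exact trace_eq_zero_of_mem_pauliGroup (hSsub hg) hg1 (fun h => hneg (h ▸ hg))
        fun h => hneg (h ▸ hmul g hg g hg)
  have htrace : P.trace = (2 : ℂ) ^ (N - k) := by
    rw [hP, Matrix.trace_smul, htrace_sum, smul_eq_mul, pow_sub₀ _ two_ne_zero hk, mul_comm]
  refine ⟨htrace, ?_⟩
  have hproj := (isProj_stabSubspace ⟨1, hone⟩ hmul hinv).trace
  rw [hcard, Nat.cast_pow, Nat.cast_ofNat, ← hP, Matrix.trace_toLin'_eq, htrace] at hproj
  exact_mod_cast hproj.symm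
end

section
/- For every unit vector ψ ∈ ℂ^{2^N} (i.e. ∑_x |ψ x|² = 1), the squared Pauli expectation values form a probability distribution: ∑_{μ : Fin N → Fin 4} 2^{-N} · |⟨ψ, Σ^μ.mulVec ψ⟩|² = 1, where ⟨u, v⟩ := ∑_x conj(u x) · v x is the standard Hermitian inner product. -/
open Matrix

/-- The standard Hermitian inner product `⟨u, v⟩ = ∑ x, conj (u x) * v x`. -/
noncomputable def hinner {ι : Type*} [Fintype ι] (u v : ι → ℂ) : ℂ :=
  ∑ x, (starRingEnd ℂ) (u x) * v x

/-- Completeness of the Pauli matrices. -/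
theorem sum_pauli_mul_conj (a b c d : Fin 2) :
    ∑ k, pauli k a b * (starRingEnd ℂ) (pauli k c d) = if a = c ∧ b = d then 2 else 0 := by
  fin_cases a <;> fin_cases b <;> fin_cases c <;> fin_cases d <;>
    simp [pauli, Fin.sum_univ_four] <;> norm_num

/-- Completeness of the Pauli strings. -/
theorem sum_pauliString_mul_conj {N : ℕ} (x y z w : Fin N → Fin 2) :
    ∑ μ : Fin N → Fin 4, pauliString μ x y * (starRingEnd ℂ) (pauliString μ z w) =
      if x = z ∧ y = w then 2 ^ N else 0 := by
  simp only [pauliString, Matrix.of_apply, map_prod, ← Finset.prod_mul_distrib]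
  rw [← Fintype.prod_sum
    (fun i k => pauli k (x i) (y i) * (starRingEnd ℂ) (pauli k (z i) (w i)))]
  simp only [sum_pauli_mul_conj, Finset.prod_ite_zero, Finset.mem_univ, forall_const,
    forall_and, ← funext_iff, Finset.prod_const, Finset.card_univ, Fintype.card_fin]

/-- The squared Pauli expectation values of any vector sum to `2 ^ N ‖ψ‖⁴`. -/
theorem sum_normSq_hinner_pauliString {N : ℕ} (ψ : (Fin N → Fin 2) → ℂ) :
    ∑ μ : Fin N → Fin 4, Complex.normSq (hinner ψ ((pauliString μ).mulVec ψ)) =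
      2 ^ N * (∑ x, Complex.normSq (ψ x)) ^ 2 := by
  apply Complex.ofReal_injective
  push_cast
  simp only [Complex.normSq_eq_conj_mul_self]
  have expand (μ : Fin N → Fin 4) :
      hinner ψ ((pauliString μ).mulVec ψ) =
        ∑ p : (Fin N → Fin 2) × (Fin N → Fin 2),
          (starRingEnd ℂ) (ψ p.1) * ψ p.2 * pauliString μ p.1 p.2 := by
    simp only [hinner, Matrix.mulVec, dotProduct, Fintype.sum_prod_type, Finset.mul_sum]
    exact Finset.sum_congr rfl fun _ _ => Finset.sum_congr rfl fun _ _ => by ring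
  calc
    _ = ∑ q : (Fin N → Fin 2) × (Fin N → Fin 2), ∑ p : (Fin N → Fin 2) × (Fin N → Fin 2),
          (ψ q.1 * (starRingEnd ℂ) (ψ q.2) * ((starRingEnd ℂ) (ψ p.1) * ψ p.2)) *
            ∑ μ : Fin N → Fin 4,
              pauliString μ p.1 p.2 * (starRingEnd ℂ) (pauliString μ q.1 q.2) := by
      simp only [expand, map_sum, map_mul, Complex.conj_conj, Finset.sum_mul_sum]
      simp only [Finset.mul_sum]
      rw [Finset.sum_comm]
      refine Finset.sum_congr rfl fun q _ => ?_
      rw [Finset.sum_comm]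
      exact Finset.sum_congr rfl fun _ _ => Finset.sum_congr rfl fun _ _ => by ring
    _ = ∑ q : (Fin N → Fin 2) × (Fin N → Fin 2),
          (ψ q.1 * (starRingEnd ℂ) (ψ q.2) * ((starRingEnd ℂ) (ψ q.1) * ψ q.2)) * 2 ^ N := by
      simp only [sum_pauliString_mul_conj, ← Prod.ext_iff, mul_ite, mul_zero,
        Finset.sum_ite_eq', Finset.mem_univ, if_true]
    _ = _ := by
      rw [sq, Finset.sum_mul_sum, Fintype.sum_prod_type, Finset.mul_sum]
      refine Finset.sum_congr rfl fun _ _ => ?_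
      rw [Finset.mul_sum]
      exact Finset.sum_congr rfl fun _ _ => by ring

/-- For a unit vector `ψ ∈ ℂ^{2^N}`, the squared Pauli expectation values
`Π_ψ(μ) = 2^{-N} |⟨ψ, Σ^μ ψ⟩|²` form a probability distribution. -/
theorem pauli_expectations_probability {N : ℕ} (hN : 1 ≤ N)
    (ψ : (Fin N → Fin 2) → ℂ) (hψ : ∑ x, Complex.normSq (ψ x) = 1) :
    ∑ μ : Fin N → Fin 4,
      ((2 : ℝ) ^ N)⁻¹ * Complex.normSq (hinner ψ ((pauliString μ).mulVec ψ)) = 1 := by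
  rw [← Finset.mul_sum, sum_normSq_hinner_pauliString, hψ, one_pow, mul_one]
  exact inv_mul_cancel₀ (by positivity)
end

section
/- The stabilizer Rényi entropies are invariant under Clifford unitaries: let U be a unitary 2^N × 2^N complex matrix such that for every μ : Fin N → Fin 4 there exist c ∈ {1, -1, Complex.I, -Complex.I} and ν : Fin N → Fin 4 with Uᴴ * Σ^μ * U = c • Σ^ν. Then for every vector ψ ∈ ℂ^{2^N} and every natural number n ≥ 1, ∑_{μ : Fin N → Fin 4} |⟨U.mulVec ψ, Σ^μ.mulVec (U.mulVec ψ)⟩|^{2n} = ∑_{μ : Fin N → Fin 4} |⟨ψ, Σ^μ.mulVec ψ⟩|^{2n}. -/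
open Matrix

/-- The trace of a product of Pauli strings factors over the qubits. -/
theorem trace_pauliString_mul {N : ℕ} (μ ν : Fin N → Fin 4) :
    (pauliString μ * pauliString ν).trace = ∏ i, (pauli (μ i) * pauli (ν i)).trace := by
  simp only [Matrix.trace, Matrix.diag_apply, Matrix.mul_apply, pauliString, Matrix.of_apply,
    ← Finset.prod_mul_distrib, Fintype.prod_sum]

/-- The Pauli matrices are orthogonal for the trace form. -/
theorem trace_pauli_mul (a b : Fin 4) :
    (pauli a * pauli b).trace = if a = b then 2 else 0 := by
  fin_cases a <;> fin_cases b <;>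
    simp [pauli, Matrix.trace_fin_two] <;> norm_num

theorem trace_pauliString_mul_self_ne_zero {N : ℕ} (μ : Fin N → Fin 4) :
    (pauliString μ * pauliString μ).trace ≠ 0 := by
  simp [trace_pauliString_mul, trace_pauli_mul]

/-- Proportional Pauli strings are equal. -/
theorem eq_of_smul_pauliString_eq_smul {N : ℕ} {μ ν : Fin N → Fin 4} {c d : ℂ} (hc : c ≠ 0)
    (h : c • pauliString μ = d • pauliString ν) : μ = ν := by
  by_contra hne
  obtain ⟨i, hi⟩ := Function.ne_iff.mp hne
  have horth : (pauliString μ * pauliString ν).trace = 0 := by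
    rw [trace_pauliString_mul]
    exact Finset.prod_eq_zero (Finset.mem_univ i) (by simp [trace_pauli_mul, hi])
  have hd : d = 0 := by
    have ht := congrArg (fun A => (A * pauliString ν).trace) h
    simpa [horth, trace_pauliString_mul_self_ne_zero] using ht.symm
  have ht := congrArg (fun A => (A * pauliString μ).trace) h
  simp [hd, hc, trace_pauliString_mul_self_ne_zero] at ht

theorem hinner_eq_dotProduct {ι : Type*} [Fintype ι] (u v : ι → ℂ) :
    hinner u v = star u ⬝ᵥ v := rfl

/-- Expectation values in the state `U ψ` are those of the conjugated operator in `ψ`. -/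
theorem hinner_mulVec_mulVec {ι : Type*} [Fintype ι] (U A : Matrix ι ι ℂ) (ψ : ι → ℂ) :
    hinner (U.mulVec ψ) (A.mulVec (U.mulVec ψ)) = hinner ψ ((Uᴴ * A * U).mulVec ψ) := by
  simp only [hinner_eq_dotProduct, Matrix.star_mulVec, ← Matrix.dotProduct_mulVec,
    Matrix.mulVec_mulVec, Matrix.mul_assoc]

theorem hinner_smul_right {ι : Type*} [Fintype ι] (c : ℂ) (u v : ι → ℂ) :
    hinner u (c • v) = c * hinner u v := by
  simp [hinner_eq_dotProduct]

/-- Stabilizer Rényi entropies are invariant under Clifford unitaries: if `U` is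
unitary and conjugates every Pauli string into a phase times a Pauli string, then
the sums `∑_μ |⟨Uψ, Σ^μ (Uψ)⟩|^{2n}` are unchanged. -/
theorem SRE_clifford_invariant {N : ℕ} (hN : 1 ≤ N)
    (U : Matrix (Fin N → Fin 2) (Fin N → Fin 2) ℂ)
    (hU : Uᴴ * U = 1) (hU' : U * Uᴴ = 1)
    (hClifford : ∀ μ : Fin N → Fin 4,
      ∃ c ∈ ({1, -1, Complex.I, -Complex.I} : Set ℂ), ∃ ν : Fin N → Fin 4,
        Uᴴ * pauliString μ * U = c • pauliString ν)
    (ψ : (Fin N → Fin 2) → ℂ) (n : ℕ) (hn : 1 ≤ n) :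
    ∑ μ : Fin N → Fin 4,
        Complex.normSq (hinner (U.mulVec ψ)
          ((pauliString μ).mulVec (U.mulVec ψ))) ^ n =
      ∑ μ : Fin N → Fin 4,
        Complex.normSq (hinner ψ ((pauliString μ).mulVec ψ)) ^ n := by
  choose c hc f hf using hClifford
  have hnorm : ∀ μ, Complex.normSq (c μ) = 1 := fun μ => by
    have h := hc μ
    simp only [Set.mem_insert_iff, Set.mem_singleton_iff] at h
    rcases h with h | h | h | h <;> simp [h]
  have hne : ∀ μ, c μ ≠ 0 := fun μ h => by simpa [h] using hnorm μ
  have hconj : ∀ μ, pauliString μ = c μ • (U * pauliString (f μ) * Uᴴ) := fun μ => by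
    rw [← Matrix.smul_mul, ← Matrix.mul_smul, ← hf]
    simp only [Matrix.mul_assoc, hU', Matrix.mul_one]
    rw [← Matrix.mul_assoc, hU', Matrix.one_mul]
  have hinj : Function.Injective f := fun μ ν h => by
    refine eq_of_smul_pauliString_eq_smul (hne ν) (d := c μ) ?_
    rw [hconj μ, hconj ν, h, smul_comm]
  refine Fintype.sum_bijective f (Finite.injective_iff_bijective.mp hinj) _ _ fun μ => ?_
  rw [hinner_mulVec_mulVec, hf, Matrix.smul_mulVec, hinner_smul_right, Complex.normSq_mul,
    hnorm, one_mul]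
end

section
/- Every density matrix admits a purification: if ρ is a d × d complex matrix that is positive semidefinite with trace(ρ) = 1, then there exists a vector ψ : Fin d × Fin d → ℂ with ∑_{(a,b)} |ψ (a,b)|² = 1 such that the partial trace over the second factor of the rank-one projector |ψ⟩⟨ψ| equals ρ, i.e. for all a a' : Fin d, ∑_b ψ (a,b) · conj(ψ (a',b)) = ρ a a'. -/
open Matrix
open scoped ComplexOrder

/-- Every density matrix admits a purification: if `ρ` is positive semidefinite with
unit trace, there is a unit vector `ψ ∈ ℂ^d ⊗ ℂ^d` whose rank-one projector has
partial trace over the second factor equal to `ρ`. -/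
theorem density_matrix_purification {d : ℕ} (ρ : Matrix (Fin d) (Fin d) ℂ)
    (hρ : ρ.PosSemidef) (htr : ρ.trace = 1) :
    ∃ ψ : Fin d × Fin d → ℂ,
      (∑ p : Fin d × Fin d, Complex.normSq (ψ p) = 1) ∧
      ∀ a a' : Fin d, (∑ b : Fin d, ψ (a, b) * (starRingEnd ℂ) (ψ (a', b))) = ρ a a' := by
  obtain ⟨B, rfl⟩ : ∃ B : Matrix (Fin d) (Fin d) ℂ, ρ = Bᴴ * B := by
    open scoped MatrixOrder in
    simpa [star_eq_conjTranspose] using CStarAlgebra.nonneg_iff_eq_star_mul_self.mp hρ.nonneg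
  have hpartial : ∀ a a' : Fin d,
      ∑ b : Fin d, star (B b a) * (starRingEnd ℂ) (star (B b a')) = (Bᴴ * B) a a' := by
    intro a a'
    simp [Matrix.mul_apply]
  refine ⟨fun p => star (B p.2 p.1), ?_, hpartial⟩
  rw [← Complex.ofReal_inj, Complex.ofReal_one, ← htr, Matrix.trace, Complex.ofReal_sum,
    Fintype.sum_prod_type]
  refine Finset.sum_congr rfl fun a _ => ?_
  rw [Matrix.diag_apply, ← hpartial a a]
  exact Finset.sum_congr rfl fun b _ => (Complex.mul_conj _).symm
end

section
/- Correctness of quantum teleportation: for a ∈ Fin 4 let b_a : Fin 2 × Fin 2 → ℂ be the Bell vector b_a (j,k) = (σ^a) j k / Real.sqrt 2, where σ⁰,σ¹,σ²,σ³ are the identity and the three Pauli matrices. Given any ψ : Fin 2 → ℂ, the three-qubit state Ψ(i,l,k) := ψ i · b_0 (l,k) (Alice's unknown qubit together with a shared Bell pair |𝟙⟩), projected by Alice's Bell measurement with outcome a onto Bob's qubit, gives the vector v_a k := ∑_{i,l} conj(b_a (i,l)) · Ψ(i,l,k). Then for every a : Fin 4: (i) v_a = (1/2 : ℂ) • (σ^a).mulVec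 ψ, so applying the Pauli correction yields (σ^a).mulVec v_a = (1/2 : ℂ) • ψ; and (ii) ∑_k |v_a k|² = (1/4) · ∑_i |ψ i|², so each of the four outcomes occurs with probability 1/4 when ψ is a unit vector. -/
open Matrix

/-- The Bell states: `b_a (j,k) = (σ^a)_{jk} / √2` for `a = 0, 1, 2, 3`. -/
noncomputable def bell (a : Fin 4) : Fin 2 × Fin 2 → ℂ :=
  fun p => pauli a p.1 p.2 / ((Real.sqrt 2 : ℝ) : ℂ)

/-- Bob's (unnormalized) conditional state after Alice's Bell measurement with
outcome `a` on the state `ψ ⊗ |𝟙⟩`: `v_a k = ∑_{i,l} conj(b_a (i,l)) · ψ i · b_0 (l,k)`. -/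
noncomputable def teleported (ψ : Fin 2 → ℂ) (a : Fin 4) : Fin 2 → ℂ :=
  fun k => ∑ i : Fin 2, ∑ l : Fin 2,
    (starRingEnd ℂ) (bell a (i, l)) * (ψ i * bell 0 (l, k))

theorem pauli_isHermitian (a : Fin 4) : (pauli a).IsHermitian := by
  ext i j
  fin_cases a <;> fin_cases i <;> fin_cases j <;> simp [pauli]

theorem teleported_eq_smul_mulVec (ψ : Fin 2 → ℂ) (a : Fin 4) :
    teleported ψ a = (1 / 2 : ℂ) • (pauli a).mulVec ψ := by
  have sqrt_two_mul_self : ((Real.sqrt 2 : ℝ) : ℂ) * ((Real.sqrt 2 : ℝ) : ℂ) = 2 := by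
    rw [← Complex.ofReal_mul, Real.mul_self_sqrt zero_le_two, Complex.ofReal_ofNat]
  have conj_bell_mul (i l k : Fin 2) :
      (starRingEnd ℂ) (bell a (i, l)) * (ψ i * bell 0 (l, k)) =
        (1 / 2 : ℂ) * (pauli a l i * ψ i * (1 : Matrix (Fin 2) (Fin 2) ℂ) l k) := by
    rw [← (pauli_isHermitian a).apply l i]
    simp only [bell, map_div₀, Complex.conj_ofReal]
    rw [starRingEnd_apply]
    rw [div_mul_eq_mul_div, mul_div_assoc', mul_div_assoc', div_div, sqrt_two_mul_self]
    simp only [pauli, Matrix.cons_val_zero]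
    ring
  ext k
  rw [Pi.smul_apply, smul_eq_mul, Matrix.mulVec, dotProduct]
  simp [teleported, conj_bell_mul, Matrix.one_apply, mul_add]

theorem sum_normSq_eq_star_dotProduct {n : Type*} [Fintype n] (v : n → ℂ) :
    ((∑ k, Complex.normSq (v k) : ℝ) : ℂ) = star v ⬝ᵥ v := by
  simp [dotProduct, Complex.normSq_eq_conj_mul_self]

theorem sum_normSq_pauli_mulVec (ψ : Fin 2 → ℂ) (a : Fin 4) :
    ∑ k, Complex.normSq ((pauli a).mulVec ψ k) = ∑ i, Complex.normSq (ψ i) := by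
  apply Complex.ofReal_injective
  rw [sum_normSq_eq_star_dotProduct, sum_normSq_eq_star_dotProduct, Matrix.star_mulVec,
    (pauli_isHermitian a).eq, ← Matrix.dotProduct_mulVec, Matrix.mulVec_mulVec,
    pauli_mul_self, Matrix.one_mulVec]

/-- Correctness of quantum teleportation: for each Bell outcome `a`, Bob's conditional
state is `(1/2) σ^a ψ`, so the Pauli correction recovers `(1/2) ψ`, and each outcome
occurs with probability `1/4` for a unit input state. -/
theorem quantum_teleportation (ψ : Fin 2 → ℂ) (a : Fin 4) :
    teleported ψ a = (1 / 2 : ℂ) • (pauli a).mulVec ψ ∧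
    (pauli a).mulVec (teleported ψ a) = (1 / 2 : ℂ) • ψ ∧
    ∑ k : Fin 2, Complex.normSq (teleported ψ a k) =
      (1 / 4 : ℝ) * ∑ i : Fin 2, Complex.normSq (ψ i) := by
  refine ⟨teleported_eq_smul_mulVec ψ a, ?_, ?_⟩
  · rw [teleported_eq_smul_mulVec, Matrix.mulVec_smul, Matrix.mulVec_mulVec, pauli_mul_self,
      Matrix.one_mulVec]
  · rw [teleported_eq_smul_mulVec, ← sum_normSq_pauli_mulVec ψ a, Finset.mul_sum]
    refine Finset.sum_congr rfl fun k _ => ?_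
    rw [Pi.smul_apply, smul_eq_mul, Complex.normSq_mul]
    norm_num [Complex.normSq_apply]
end
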